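/- arXiv:2302.08562 — 4 statements merged into one kernel-verified Lean document; each statement's English description precedes it below -/
import Mathlib

section
/- Let X be an object of C. Then X is dualisable if and only if there exists a morphism η : 𝟙 ⟶ X ⊗ DX such that the composite 𝟙 ⟶ X ⊗ DX ⟶ DX ⊗ X ⟶ [X,X], given by η followed by the braiding γ followed by the canonical map DX ⊗ X ⟶ [X,X], is equal to the morphism 𝟙 ⟶ [X,X] adjoint to the left unitor isomorphism 𝟙 ⊗ X ≅ X. -/
open CategoryTheory MonoidalCategory MonoidalClosed

universe v u

variable {C : Type u} [Category.{v} C] [MonoidalCategory C] [SymmetricCategory C]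
  [MonoidalClosed C]

/-- The evaluation map `[X,Y] ⊗ X ⟶ Y` (the adjunction counit, in the paper's convention). -/
noncomputable def ev' (X Y : C) : (ihom X).obj Y ⊗ X ⟶ Y :=
  (β_ ((ihom X).obj Y) X).hom ≫ (ihom.ev X).app Y

/-- The canonical map `ν : [X,Y] ⊗ Z ⟶ [X, Y ⊗ Z]`, adjoint to the composite
`([X,Y] ⊗ Z) ⊗ X ⟶ ([X,Y] ⊗ X) ⊗ Z ⟶ Y ⊗ Z` of the braiding (exchanging `Z` and `X`)
with `ε ⊗ 1`. -/
noncomputable def ν (X Y Z : C) : (ihom X).obj Y ⊗ Z ⟶ (ihom X).obj (Y ⊗ Z) :=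
  curry ((β_ X ((ihom X).obj Y ⊗ Z)).hom ≫ (α_ ((ihom X).obj Y) Z X).hom ≫
    (((ihom X).obj Y) ◁ (β_ Z X).hom) ≫ (α_ ((ihom X).obj Y) X Z).inv ≫
    ((ev' X Y) ▷ Z))

/-- The Spanier–Whitehead dual `DX := [X, 𝟙]`. -/
noncomputable def D (X : C) : C := (ihom X).obj (𝟙_ C)

/-- The canonical map `DX ⊗ Y ⟶ [X,Y]`. -/
noncomputable def canMap (X Y : C) : D X ⊗ Y ⟶ (ihom X).obj Y :=
  ν X (𝟙_ C) Y ≫ (ihom X).map (λ_ Y).hom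

/-- An object `X` is dualisable if `DX ⊗ Y ⟶ [X,Y]` is an isomorphism for all `Y`. -/
def Dualisable (X : C) : Prop := ∀ Y : C, IsIso (canMap X Y)

/-- The evaluation `X ⊗ D X ⟶ 𝟙` of the internal hom. -/
noncomputable def dualEv (X : C) : X ⊗ D X ⟶ 𝟙_ C := (ihom.ev X).app (𝟙_ C)

/-- Moving `X` past `W ⊗ Z` and then back past `Z` and `W` separately is a reassociation. -/
theorem braiding_tensor_right_cancel {E : Type*} [Category* E] [MonoidalCategory E]
    [SymmetricCategory E] (X W Z : E) :
    (β_ X (W ⊗ Z)).hom ≫ (α_ W Z X).hom ≫ (W ◁ (β_ Z X).hom) ≫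
      (α_ W X Z).inv ≫ (β_ W X).hom ▷ Z = (α_ X W Z).inv := by
  rw [BraidedCategory.braiding_tensor_right_hom]
  simp only [Category.assoc, Iso.inv_hom_id_assoc]
  rw [← whiskerLeft_comp_assoc, SymmetricCategory.symmetry]
  simp [← comp_whiskerRight]

/-- The map adjoint to `canMap X Y` evaluates `X ⊗ D X` and leaves `Y` unchanged. -/
theorem uncurry_canMap (X Y : C) :
    uncurry (canMap X Y) = (α_ X (D X) Y).inv ≫ dualEv X ▷ Y ≫ (λ_ Y).hom := by
  refine (uncurry_natural_right (ν X (𝟙_ C) Y) (λ_ Y).hom).trans ?_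
  rw [ν, uncurry_curry, ev']
  refine Eq.trans ?_ (braiding_tensor_right_cancel X ((ihom X).obj (𝟙_ C)) Y =≫
    ((ihom.ev X).app (𝟙_ C) ▷ Y ≫ (λ_ Y).hom))
  simp only [Category.assoc, comp_whiskerRight]

/-- A morphism `𝟙 ⟶ D X ⊗ X` satisfying the triangle identity for `X` exhibits `D X` and `X` as
an exact pairing whose evaluation is that of the internal hom. -/
@[reducible]
noncomputable def exactPairingOfTriangle (X : C) (η : 𝟙_ C ⟶ D X ⊗ X)
    (h : X ◁ η ≫ (α_ X (D X) X).inv ≫ dualEv X ▷ X =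
      (ρ_ X).hom ≫ (λ_ X).inv) :
    ExactPairing (D X) X where
  coevaluation' := η
  evaluation' := dualEv X
  coevaluation_evaluation' := h
  evaluation_coevaluation' := by
    set e := dualEv X
    suffices H : (λ_ (D X)).inv ≫ (η ▷ D X ≫ (α_ (D X) X (D X)).hom ≫ D X ◁ e) ≫
        (ρ_ (D X)).hom = 𝟙 (D X) by
      rw [Iso.inv_comp_eq, ← Iso.eq_comp_inv] at H
      simpa using H
    have ev_injective : ∀ f g : D X ⟶ D X, X ◁ f ≫ e = X ◁ g ≫ e → f = g := fun f g hfg =>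
      uncurry_injective (A := X) (Y := D X) (X := 𝟙_ C)
        ((uncurry_eq f).trans (hfg.trans (uncurry_eq g).symm))
    apply ev_injective
    have interchange : X ◁ D X ◁ e ≫ X ◁ (ρ_ (D X)).hom ≫ e =
        (α_ X (D X) (X ⊗ D X)).inv ≫ e ▷ (X ⊗ D X) ≫ (λ_ _).hom ≫ e := by
      have hx := whisker_exchange e e
      calc _ = (α_ X (D X) (X ⊗ D X)).inv ≫ ((X ⊗ D X) ◁ e ≫ e ▷ 𝟙_ C) ≫ (λ_ _).hom := by
            simp [unitors_equal]
        _ = _ := by rw [hx]; simp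
    calc _ = X ◁ (λ_ (D X)).inv ≫ X ◁ η ▷ D X ≫ X ◁ (α_ (D X) X (D X)).hom ≫
          (X ◁ D X ◁ e ≫ X ◁ (ρ_ (D X)).hom ≫ e) := by simp
      _ = X ◁ (λ_ (D X)).inv ≫ (α_ X (𝟙_ C) (D X)).inv ≫
          (X ◁ η ≫ (α_ X (D X) X).inv ≫ e ▷ X) ▷ D X ≫ (λ_ X).hom ▷ D X ≫ e := by
            rw [interchange]; simp
      _ = X ◁ 𝟙 (D X) ≫ e := by rw [h]; simp

/-- If the evaluation of the internal hom underlies an exact pairing of `D X` and `X`, then `X` is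
dualisable. -/
theorem dualisable_of_exactPairing (X : C) [P : ExactPairing (D X) X]
    (hP : ε_ (D X) X = dualEv X) : Dualisable X := by
  intro Y
  let adj := tensorLeftAdjunction (D X) X
  have hcan : canMap X Y = (adj.rightAdjointUniq (ihom.adjunction X)).hom.app Y := by
    apply uncurry_injective
    have hu := Adjunction.rightAdjointUniq_hom_app_counit adj (ihom.adjunction X) Y
    rw [uncurry_canMap, uncurry_eq]
    refine Eq.trans ?_ hu.symm
    simp [adj, tensorLeftAdjunction, tensorLeftHomEquiv, Adjunction.mkOfHomEquiv, hP]
  rw [hcan]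
  infer_instance

theorem stmt0 (X : C) :
    Dualisable X ↔ ∃ η : 𝟙_ C ⟶ X ⊗ D X,
      η ≫ (β_ X (D X)).hom ≫ canMap X X =
        curry ((β_ X (𝟙_ C)).hom ≫ (λ_ X).hom) := by
  constructor
  · intro hX
    have := hX X
    exact ⟨curry ((β_ X (𝟙_ C)).hom ≫ (λ_ X).hom) ≫ inv (canMap X X) ≫ (β_ X (D X)).inv,
      by simp⟩
  · rintro ⟨η, h⟩
    have triangle : X ◁ (η ≫ (β_ X (D X)).hom) ≫ (α_ X (D X) X).inv ≫
        dualEv X ▷ X = (ρ_ X).hom ≫ (λ_ X).inv := by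
      rw [← Category.assoc, eq_curry_iff, uncurry_natural_left, uncurry_canMap,
        braiding_leftUnitor] at h
      simpa [← Iso.eq_comp_inv] using h =≫ (λ_ X).inv
    let _ := exactPairingOfTriangle X (η ≫ (β_ X (D X)).hom) triangle
    exact dualisable_of_exactPairing X rfl
end

section
/- Let X, Y, Z be objects of C. If either X is dualisable or Z is dualisable, then the canonical map ν : [X,Y] ⊗ Z ⟶ [X, Y ⊗ Z] is an isomorphism. -/
open CategoryTheory MonoidalCategory MonoidalClosed

universe v u

variable {C : Type u} [Category.{v} C] [MonoidalCategory C] [SymmetricCategory C]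
  [MonoidalClosed C]

/-- Evaluation `X ⊗ [X,Y] ⟶ Y`, with its source written as a tensor product. -/
noncomputable def evalLeft (X Y : C) : X ⊗ (ihom X).obj Y ⟶ Y :=
  (ihom.ev X).app Y

theorem uncurry_eq_evalLeft {E : Type*} [Category* E] [MonoidalCategory E] [MonoidalClosed E]
    {X Y Z : E} (f : Z ⟶ (ihom X).obj Y) :
    uncurry f = X ◁ f ≫ evalLeft X Y :=
  rfl

theorem evalLeft_naturality {E : Type*} [Category* E] [MonoidalCategory E] [MonoidalClosed E]
    (X : E) {Y Y' : E} (f : Y ⟶ Y') :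
    X ◁ (ihom X).map f ≫ evalLeft X Y' = evalLeft X Y ≫ f :=
  ihom.ev_naturality X f

/-- `ν` is the transpose of evaluation tensored with the last factor; no braiding is involved. -/
theorem ν_eq_curry (X Y Z : C) :
    ν X Y Z = curry ((α_ X ((ihom X).obj Y) Z).inv ≫ evalLeft X Y ▷ Z) := by
  have h : (β_ X ((ihom X).obj Y ⊗ Z)).hom ≫ (α_ ((ihom X).obj Y) Z X).hom ≫
      ((ihom X).obj Y ◁ (β_ Z X).hom) ≫ (α_ ((ihom X).obj Y) X Z).inv ≫
      (β_ ((ihom X).obj Y) X).hom ▷ Z = (α_ X ((ihom X).obj Y) Z).inv := by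
    simp [BraidedCategory.braiding_tensor_right_hom, ← whiskerLeft_comp_assoc,
      ← comp_whiskerRight]
  have hev : ev' X Y = (β_ ((ihom X).obj Y) X).hom ≫ evalLeft X Y := rfl
  rw [ν, hev, comp_whiskerRight, ← h]
  simp only [Category.assoc]

theorem uncurry_ν (X Y Z : C) :
    uncurry (ν X Y Z) = (α_ X ((ihom X).obj Y) Z).inv ≫ evalLeft X Y ▷ Z := by
  rw [ν_eq_curry, uncurry_curry]

theorem ν_naturality_middle (X : C) {Y Y' : C} (f : Y ⟶ Y') (Z : C) :
    (ihom X).map f ▷ Z ≫ ν X Y' Z = ν X Y Z ≫ (ihom X).map (f ▷ Z) := by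
  apply uncurry_injective
  rw [uncurry_natural_right, uncurry_natural_left, uncurry_ν, uncurry_ν,
    associator_inv_naturality_middle_assoc, ← comp_whiskerRight, evalLeft_naturality,
    comp_whiskerRight, Category.assoc]

theorem ν_naturality_right (X Y : C) {Z Z' : C} (f : Z ⟶ Z') :
    (ihom X).obj Y ◁ f ≫ ν X Y Z' = ν X Y Z ≫ (ihom X).map (Y ◁ f) := by
  apply uncurry_injective
  rw [uncurry_natural_right, uncurry_natural_left, uncurry_ν, uncurry_ν,
    associator_inv_naturality_right_assoc, whisker_exchange, Category.assoc]

theorem ν_associativity (X Y Z W : C) :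
    ν X Y Z ▷ W ≫ ν X (Y ⊗ Z) W =
      (α_ ((ihom X).obj Y) Z W).hom ≫ ν X Y (Z ⊗ W) ≫ (ihom X).map (α_ Y Z W).inv := by
  apply uncurry_injective
  rw [← Category.assoc, uncurry_natural_right, uncurry_natural_left, uncurry_natural_left,
    uncurry_ν, uncurry_ν, associator_inv_naturality_middle_assoc, ← comp_whiskerRight,
    ← uncurry_eq_evalLeft, uncurry_ν]
  monoidal

theorem ν_unitality (X Y : C) :
    ν X Y (𝟙_ C) ≫ (ihom X).map (ρ_ Y).hom = (ρ_ ((ihom X).obj Y)).hom := by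
  apply uncurry_injective
  rw [uncurry_natural_right, uncurry_ν, uncurry_eq_evalLeft]
  monoidal

/-- The canonical map `[X,𝟙] ⊗ Y ⟶ [X,Y]`, with the dual of `X` unfolded. -/
noncomputable def dualMap (X Y : C) : (ihom X).obj (𝟙_ C) ⊗ Y ⟶ (ihom X).obj Y :=
  ν X (𝟙_ C) Y ≫ (ihom X).map (λ_ Y).hom

theorem Dualisable.isIso_dualMap {X : C} (hX : Dualisable X) (Y : C) : IsIso (dualMap X Y) :=
  hX Y

theorem dualMap_whiskerRight_ν (X Y Z : C) :
    dualMap X Y ▷ Z ≫ ν X Y Z =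
      (α_ ((ihom X).obj (𝟙_ C)) Y Z).hom ≫ dualMap X (Y ⊗ Z) := by
  simp only [dualMap, comp_whiskerRight, Category.assoc]
  rw [ν_naturality_middle, ← Category.assoc, ν_associativity, Category.assoc, Category.assoc,
    ← Functor.map_comp, leftUnitor_tensor_hom]

theorem Dualisable.isIso_ν_left {X : C} (hX : Dualisable X) (Y Z : C) : IsIso (ν X Y Z) := by
  have := hX.isIso_dualMap Y
  have := hX.isIso_dualMap (Y ⊗ Z)
  have : IsIso (dualMap X Y ▷ Z ≫ ν X Y Z) := by
    rw [dualMap_whiskerRight_ν]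
    infer_instance
  exact IsIso.of_isIso_comp_left (dualMap X Y ▷ Z) _

theorem uncurry_dualMap (X Y : C) :
    uncurry (dualMap X Y) = (α_ X ((ihom X).obj (𝟙_ C)) Y).inv ≫
      evalLeft X (𝟙_ C) ▷ Y ≫ (λ_ Y).hom := by
  rw [dualMap, uncurry_natural_right, uncurry_ν, Category.assoc]

/-- The coevaluation `𝟙 ⟶ [Z,𝟙] ⊗ Z` of an object for which `[Z,𝟙] ⊗ Z ⟶ [Z,Z]` is invertible. -/
noncomputable def dualCoev (Z : C) [IsIso (dualMap Z Z)] :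
    𝟙_ C ⟶ (ihom Z).obj (𝟙_ C) ⊗ Z :=
  curry (ρ_ Z).hom ≫ inv (dualMap Z Z)

theorem dualCoev_evalLeft (Z : C) [IsIso (dualMap Z Z)] :
    Z ◁ dualCoev Z ≫ (α_ Z ((ihom Z).obj (𝟙_ C)) Z).inv ≫ evalLeft Z (𝟙_ C) ▷ Z =
      (ρ_ Z).hom ≫ (λ_ Z).inv := by
  have h : dualCoev Z ≫ dualMap Z Z = curry (ρ_ Z).hom := by
    rw [dualCoev, Category.assoc, IsIso.inv_hom_id, Category.comp_id]
  rw [Iso.eq_comp_inv, ← uncurry_curry (ρ_ Z).hom, ← h, uncurry_natural_left, uncurry_dualMap]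
  simp only [Category.assoc]

/-- If the first triangle identity holds for `c` and `e`, then the endomorphism of `H` occurring in
the second one is invisible after pairing with `e`. -/
theorem whiskerLeft_triangle_comp_evaluation {E : Type*} [Category* E] [MonoidalCategory E]
    {Z H : E} (e : Z ⊗ H ⟶ 𝟙_ E) (c : 𝟙_ E ⟶ H ⊗ Z)
    (h : Z ◁ c ≫ (α_ Z H Z).inv ≫ e ▷ Z = (ρ_ Z).hom ≫ (λ_ Z).inv) :
    Z ◁ (c ▷ H ≫ (α_ H Z H).hom ≫ H ◁ e ≫ (ρ_ H).hom) ≫ e = Z ◁ (λ_ H).hom ≫ e := by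
  calc
    _ = 𝟙 _ ⊗≫ Z ◁ c ▷ H ⊗≫ ((Z ⊗ H) ◁ e ≫ e ▷ 𝟙_ E) ⊗≫ 𝟙 _ := by monoidal
    _ = 𝟙 _ ⊗≫ (Z ◁ c ≫ (α_ Z H Z).inv ≫ e ▷ Z) ▷ H ⊗≫ e := by
      rw [whisker_exchange]; monoidal
    _ = _ := by rw [h]; monoidal

theorem evalLeft_dualCoev (Z : C) [IsIso (dualMap Z Z)] :
    dualCoev Z ▷ (ihom Z).obj (𝟙_ C) ≫
      (α_ ((ihom Z).obj (𝟙_ C)) Z ((ihom Z).obj (𝟙_ C))).hom ≫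
      (ihom Z).obj (𝟙_ C) ◁ evalLeft Z (𝟙_ C) =
      (λ_ ((ihom Z).obj (𝟙_ C))).hom ≫ (ρ_ ((ihom Z).obj (𝟙_ C))).inv := by
  rw [Iso.eq_comp_inv, Category.assoc, Category.assoc]
  apply uncurry_injective
  rw [uncurry_eq_evalLeft, uncurry_eq_evalLeft]
  exact whiskerLeft_triangle_comp_evaluation _ _ (dualCoev_evalLeft Z)

/-- The pairing exhibiting `[Z,𝟙]` and `Z` as duals of each other. -/
@[reducible]
noncomputable def dualPairing (Z : C) [IsIso (dualMap Z Z)] :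
    ExactPairing ((ihom Z).obj (𝟙_ C)) Z where
  coevaluation' := dualCoev Z
  evaluation' := evalLeft Z (𝟙_ C)
  coevaluation_evaluation' := dualCoev_evalLeft Z
  evaluation_coevaluation' := evalLeft_dualCoev Z

section ExactPairing

variable {E : Type*} [Category* E] [MonoidalCategory E]

/-- Contraction of the last two factors along a dual pairing. -/
def contract (W Y Z : E) [ExactPairing W Z] : (Y ⊗ Z) ⊗ W ⟶ Y :=
  (α_ Y Z W).hom ≫ Y ◁ ε_ W Z ≫ (ρ_ Y).hom

/-- Insertion of a dual pairing to the right of an object. -/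
def expand (W Z H : E) [ExactPairing W Z] : H ⟶ (H ⊗ W) ⊗ Z :=
  (ρ_ H).inv ≫ H ◁ η_ W Z ≫ (α_ H W Z).inv

theorem expand_contract (W Y Z : E) [ExactPairing W Z] :
    expand W Z (Y ⊗ Z) ≫ contract W Y Z ▷ Z = 𝟙 _ := by
  calc
    _ = 𝟙 _ ⊗≫ Y ◁ (Z ◁ η_ W Z ⊗≫ ε_ W Z ▷ Z) ⊗≫ 𝟙 _ := by
      simp only [expand, contract]; monoidal
    _ = 𝟙 _ := by rw [ExactPairing.coevaluation_evaluation'']; monoidal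

end ExactPairing

theorem isIso_ν_of_exactPairing (X Y Z W : C) [ExactPairing W Z] : IsIso (ν X Y Z) := by
  refine ⟨expand W Z _ ≫ (ν X (Y ⊗ Z) W ≫ (ihom X).map (contract W Y Z)) ▷ Z, ?_, ?_⟩
  · have h : ν X Y Z ▷ W ≫ ν X (Y ⊗ Z) W ≫ (ihom X).map (contract W Y Z) =
        contract W ((ihom X).obj Y) Z := by
      rw [contract, ← Category.assoc, ν_associativity]
      simp only [Category.assoc, ← Functor.map_comp, Iso.inv_hom_id_assoc]
      rw [Functor.map_comp, ← Category.assoc (ν X Y (Z ⊗ W)), ← ν_naturality_right,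
        Category.assoc, ν_unitality, contract]
    have h' : ν X Y Z ≫ expand W Z _ = expand W Z _ ≫ (ν X Y Z ▷ W) ▷ Z := by
      simp only [expand, Category.assoc, ← associator_inv_naturality_left,
        rightUnitor_inv_naturality_assoc, whisker_exchange_assoc]
    rw [← Category.assoc, h', Category.assoc, ← comp_whiskerRight, h, expand_contract]
  · rw [comp_whiskerRight, Category.assoc, Category.assoc, ν_naturality_middle,
      ← Category.assoc (ν X (Y ⊗ Z) W ▷ Z), ν_associativity, expand]
    have h : (ρ_ ((ihom X).obj (Y ⊗ Z))).inv ≫ ν X (Y ⊗ Z) (𝟙_ C) =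
        (ihom X).map (ρ_ (Y ⊗ Z)).inv := by
      rw [Iso.inv_comp_eq, ← ν_unitality, Category.assoc, ← Functor.map_comp, Iso.hom_inv_id,
        CategoryTheory.Functor.map_id, Category.comp_id]
    simp only [Category.assoc, Iso.inv_hom_id_assoc]
    rw [← Category.assoc (_ ◁ η_ W Z), ν_naturality_right, Category.assoc, ← Category.assoc, h]
    simp only [← Functor.map_comp]
    have := expand_contract W Y Z
    simp only [expand, Category.assoc] at this
    rw [this, CategoryTheory.Functor.map_id]

theorem stmt2 (X Y Z : C) (h : Dualisable X ∨ Dualisable Z) :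
    IsIso (ν X Y Z) := by
  rcases h with hX | hZ
  · exact hX.isIso_ν_left Y Z
  · have := hZ.isIso_dualMap Z
    have := dualPairing Z
    exact isIso_ν_of_exactPairing X Y Z ((ihom Z).obj (𝟙_ C))
end

section
/- If X is a dualisable object of C, then X is functionally compact; that is, for every set-indexed family {Y_i} of objects the canonical map ⨁_i [X, Y_i] ⟶ [X, ⨁_i Y_i] is an isomorphism. -/
open CategoryTheory MonoidalCategory MonoidalClosed

universe v u

variable {C : Type u} [Category.{v} C] [MonoidalCategory C] [SymmetricCategory C]
  [MonoidalClosed C]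

open CategoryTheory.Limits

variable [HasCoproducts.{v} C]

/-- An object `W` is compact if for every set-indexed family `{Y i}` the canonical map
`⨁ᵢ Hom(W, Yᵢ) ⟶ Hom(W, ⨁ᵢ Yᵢ)` is bijective. -/
def Compact (W : C) : Prop := ∀ (ι : Type v) (Y : ι → C),
    Function.Bijective (fun p : Σ i : ι, (W ⟶ Y i) => p.2 ≫ Sigma.ι Y p.1)

/-- An object `X` is functionally compact if for every set-indexed family `{Y i}` the
canonical map `⨁ᵢ [X, Yᵢ] ⟶ [X, ⨁ᵢ Yᵢ]` is an isomorphism. -/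
def FunctionallyCompact (X : C) : Prop := ∀ (ι : Type v) (Y : ι → C),
    IsIso (Sigma.desc (fun i => (ihom X).map (Sigma.ι Y i)) :
      (∐ fun i => (ihom X).obj (Y i)) ⟶ (ihom X).obj (∐ Y))

theorem ν_natural (X Y : C) {Z W : C} (f : Z ⟶ W) :
    (ihom X).obj Y ◁ f ≫ ν X Y W = ν X Y Z ≫ (ihom X).map (Y ◁ f) := by
  unfold ν
  rw [← curry_natural_left, ← curry_natural_right]
  congr 1
  simp only [Category.assoc]
  rw [BraidedCategory.braiding_naturality_right_assoc, ← whisker_exchange,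
    associator_naturality_middle_assoc,
    ← whiskerLeft_comp_assoc, BraidedCategory.braiding_naturality_left, whiskerLeft_comp_assoc,
    associator_inv_naturality_right_assoc]

theorem canMap_natural (X : C) {Y Z : C} (f : Y ⟶ Z) :
    D X ◁ f ≫ canMap X Z = canMap X Y ≫ (ihom X).map f := by
  unfold canMap D
  rw [← Category.assoc, ν_natural, Category.assoc, Category.assoc, ← Functor.map_comp,
    ← Functor.map_comp, leftUnitor_naturality]

/-- For `X` dualisable, the canonical maps assemble into `DX ⊗ - ≅ [X, -]`. -/
noncomputable def Dualisable.tensorLeftIso {X : C} (hX : Dualisable X) :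
    tensorLeft (D X) ≅ ihom X :=
  NatIso.ofComponents (fun Y => @asIso _ _ _ _ (canMap X Y) (hX Y))
    (fun f => canMap_natural X f)

theorem stmt4 (X : C) (hX : Dualisable X) : FunctionallyCompact X := by
  intro ι Y
  have : PreservesColimitsOfSize.{v, v} (tensorLeft (D X)) :=
    (ihom.adjunction (D X)).leftAdjoint_preservesColimits
  have : PreservesColimitsOfShape (Discrete ι) (ihom X) :=
    preservesColimitsOfShape_of_natIso hX.tensorLeftIso
  exact inferInstanceAs (IsIso (sigmaComparison (ihom X) Y))
end

section
/- Let (A, 𝔪, k) be a commutative noetherian local ring and let Â denote the 𝔪-adic completion of A. Let M be an A-module that is 𝔪-adically complete (the natural map M ⟶ lim_n M/𝔪^n M is an isomorphism). If the k-vector space M/𝔪M is one-dimensional and Tor_i^A(k, M) = 0 for all i ≥ 1, then M is isomorphic to Â as an A-module. -/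
open CategoryTheory CategoryTheory.Limits IsLocalRing

universe u

open scoped TensorProduct in
/-- If `Tor₁(A/I, M) = 0`, then `M` is a quotient `P/K` with `P` projective and `K ∩ I P ≤ I K`. -/
lemma exists_projective_inf_smul_le_of_isZero_tor {A : Type u} [CommRing A] (I : Ideal A)
    (M : Type u) [AddCommGroup M] [Module A M]
    (h : IsZero (((Tor (ModuleCat.{u} A) 1).obj (ModuleCat.of A (A ⧸ I))).obj
      (ModuleCat.of A M))) :
    ∃ (P : Type u) (_ : AddCommGroup P) (_ : Module A P) (_ : Module.Projective A P)
      (π : P →ₗ[A] M), Function.Surjective π ∧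
        LinearMap.ker π ⊓ I • ⊤ ≤ I • LinearMap.ker π := by
  let Q := projectiveResolution (ModuleCat.of A M)
  let F := (MonoidalCategory.tensoringLeft (ModuleCat.{u} A)).obj (ModuleCat.of A (A ⧸ I))
  have hex : (((F.mapHomologicalComplex (ComplexShape.down ℕ)).obj Q.complex).sc' 2 1 0).Exact := by
    rw [← HomologicalComplex.exactAt_iff' _ 2 1 0 (by simp) (by simp),
      HomologicalComplex.exactAt_iff_isZero_homology]
    exact h.of_iso (Q.isoLeftDerivedObj F 1).symm
  rw [ShortComplex.moduleCat_exact_iff] at hex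
  have h0 := Q.exact₀
  rw [ShortComplex.moduleCat_exact_iff] at h0
  refine ⟨Q.complex.X 0, inferInstance, inferInstance,
    (IsProjective.iff_projective _).2 (Q.projective 0), (Q.π.f 0).hom,
    (ModuleCat.epi_iff_surjective (Q.π.f 0)).1 inferInstance, ?_⟩
  rintro z ⟨hz, hzI⟩
  obtain ⟨w, rfl⟩ : ∃ w : Q.complex.X 1, (Q.complex.d 1 0).hom w = z := h0 z hz
  have hw : (1 : A ⧸ I) ⊗ₜ[A] (Q.complex.d 1 0).hom w = 0 := by
    apply (TensorProduct.quotTensorEquivQuotSMul _ I).injective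
    rw [TensorProduct.quotTensorEquivQuotSMul_mk_one_tmul, map_zero]
    exact (Submodule.Quotient.mk_eq_zero _).2 hzI
  obtain ⟨v, hv⟩ : ∃ v : (A ⧸ I) ⊗[A] Q.complex.X 2,
    (Q.complex.d 2 1).hom.lTensor (A ⧸ I) v = (1 : A ⧸ I) ⊗ₜ[A] w := hex _ hw
  obtain ⟨v, rfl⟩ : ∃ v', v = (1 : A ⧸ I) ⊗ₜ[A] v' := by
    obtain ⟨v', hv'⟩ := Submodule.Quotient.mk_surjective _
      (TensorProduct.quotTensorEquivQuotSMul _ I v)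
    refine ⟨v', (TensorProduct.quotTensorEquivQuotSMul _ I).injective ?_⟩
    rw [TensorProduct.quotTensorEquivQuotSMul_mk_one_tmul, hv']
  rw [LinearMap.lTensor_tmul] at hv
  have hwv : w - (Q.complex.d 2 1).hom v ∈ I • (⊤ : Submodule A (Q.complex.X 1)) := by
    apply_fun TensorProduct.quotTensorEquivQuotSMul _ I at hv
    rw [TensorProduct.quotTensorEquivQuotSMul_mk_one_tmul,
      TensorProduct.quotTensorEquivQuotSMul_mk_one_tmul] at hv
    exact (Submodule.Quotient.eq _).1 hv.symm
  have hd : (Q.complex.d 1 0).hom (w - (Q.complex.d 2 1).hom v) = (Q.complex.d 1 0).hom w := by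
    have : (Q.complex.d 1 0).hom ((Q.complex.d 2 1).hom v) = 0 :=
      LinearMap.congr_fun (congrArg ModuleCat.Hom.hom (Q.complex.d_comp_d 2 1 0)) v
    rw [map_sub, this, sub_zero]
  rw [← hd]
  have hmem := Submodule.mem_map_of_mem (f := (Q.complex.d 1 0).hom) hwv
  rw [Submodule.map_smul''] at hmem
  refine Submodule.smul_mono le_rfl ?_ hmem
  rintro _ ⟨y, -, rfl⟩
  exact LinearMap.congr_fun (congrArg ModuleCat.Hom.hom Q.complex_d_comp_π_f_zero) y

/-- If `x` generates `M` modulo `I ^ n M` and `M = P/K` with `P` projective and `K ∩ I P ≤ I K`,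
then an element of `I` multiplying `x` into `I ^ n M` lies in `I ^ n`. -/
lemma mem_pow_of_smul_mem_pow_smul_top {A M P : Type*} [CommRing A] [AddCommGroup M] [Module A M]
    [AddCommGroup P] [Module A P] [Module.Projective A P] {I : Ideal A} {π : P →ₗ[A] M}
    (hπ : Function.Surjective π)
    (hK : LinearMap.ker π ⊓ I • ⊤ ≤ I • LinearMap.ker π) {x : M} {n : ℕ} (hn : n ≠ 0)
    (hx : Function.Surjective
      ((I ^ n • ⊤ : Submodule A M).mkQ ∘ₗ LinearMap.toSpanSingleton A M x))
    (hI : ∀ a : A, a • x ∈ (I ^ n • ⊤ : Submodule A M) → a ∈ I)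
    {a : A} (ha : a • x ∈ (I ^ n • ⊤ : Submodule A M)) : a ∈ I ^ n := by
  set f := (I ^ n • ⊤ : Submodule A M).mkQ ∘ₗ LinearMap.toSpanSingleton A M x with hf
  have hker (b : A) : b ∈ LinearMap.ker f ↔ b • x ∈ (I ^ n • ⊤ : Submodule A M) :=
    Submodule.Quotient.mk_eq_zero _
  obtain ⟨g, hg⟩ := Module.projective_lifting_property f ((I ^ n • ⊤ : Submodule A M).mkQ ∘ₗ π) hx
  have hgp (p : P) : f (g p) = (I ^ n • ⊤ : Submodule A M).mkQ (π p) := LinearMap.congr_fun hg p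
  have hstep : LinearMap.ker f ≤ I ^ n ⊔ I * LinearMap.ker f := by
    intro b hb
    have hbI := hI b ((hker b).1 hb)
    obtain ⟨p, rfl⟩ := hπ x
    have hmap : (I ^ n • ⊤ : Submodule A M) = (I ^ n • ⊤ : Submodule A P).map π := by
      rw [Submodule.map_smul'', Submodule.map_top, LinearMap.range_eq_top.2 hπ]
    obtain ⟨q, hq, hqb⟩ : b • π p ∈ (I ^ n • ⊤ : Submodule A P).map π :=
      hmap ▸ (hker b).1 hb
    have hmem : b • p - q ∈ I • LinearMap.ker π := by
      refine hK ⟨by simp [hqb], sub_mem (Submodule.smul_mem_smul hbI trivial) ?_⟩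
      exact Submodule.smul_mono_left (Ideal.pow_le_self hn) hq
    have h1 : g (b • p - q) ∈ I * LinearMap.ker f := by
      have := Submodule.mem_map_of_mem (f := g) hmem
      rw [Submodule.map_smul''] at this
      refine Submodule.smul_mono le_rfl ?_ this
      rintro _ ⟨k, hk, rfl⟩
      rw [LinearMap.mem_ker, hgp, LinearMap.mem_ker.1 hk, map_zero]
    have h2 : g q ∈ I ^ n := by
      have := Submodule.mem_map_of_mem (f := g) hq
      rw [Submodule.map_smul''] at this
      exact Submodule.smul_le.2 (fun r hr s _ ↦ Ideal.mul_mem_right s _ hr) this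
    have h3 : g p - 1 ∈ LinearMap.ker f := by
      rw [LinearMap.mem_ker, map_sub, hgp, sub_eq_zero]
      simp [hf]
    have h4 : b = g q + (g (b • p - q) - b * (g p - 1)) := by
      simp only [map_sub, map_smul, smul_eq_mul]
      ring
    rw [h4]
    exact Submodule.add_mem_sup h2 (sub_mem h1 (Ideal.mul_mem_mul hbI h3))
  have hpow (j : ℕ) : LinearMap.ker f ≤ I ^ n ⊔ I ^ j * LinearMap.ker f := by
    induction j with
    | zero => simp
    | succ j ih =>
      refine ih.trans (sup_le le_sup_left ((Ideal.mul_mono_right hstep).trans ?_))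
      rw [Ideal.mul_sup, pow_succ, mul_assoc]
      exact sup_le_sup_right Ideal.mul_le_right _
  exact (hpow n).trans (sup_le le_rfl Ideal.mul_le_left) ((hker a).2 ha)

theorem stmt9 (A : Type u) [CommRing A] [IsNoetherianRing A] [IsLocalRing A]
    (M : Type u) [AddCommGroup M] [Module A M]
    [IsAdicComplete (maximalIdeal A) M]
    (h1 : Module.finrank (A ⧸ maximalIdeal A)
      (M ⧸ ((maximalIdeal A) • (⊤ : Submodule A M))) = 1)
    (h2 : ∀ i : ℕ, 1 ≤ i →
      IsZero (((Tor (ModuleCat.{u} A) i).obj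
        (ModuleCat.of A (ResidueField A))).obj (ModuleCat.of A M))) :
    Nonempty (M ≃ₗ[A] AdicCompletion (maximalIdeal A) A) := by
  set I := maximalIdeal A
  obtain ⟨P, _, _, _, π, hπ, hK⟩ :=
    exists_projective_inf_smul_le_of_isZero_tor I M (h2 1 le_rfl)
  let : Field (A ⧸ I) := Ideal.Quotient.field I
  obtain ⟨v, hv0, hv⟩ := finrank_eq_one_iff'.1 h1
  obtain ⟨x, rfl⟩ := Submodule.Quotient.mk_surjective _ v
  have hx0 : x ∉ (I • ⊤ : Submodule A M) := fun h ↦ hv0 ((Submodule.Quotient.mk_eq_zero _).2 h)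
  let f := LinearMap.toSpanSingleton A M x
  have hf : Function.Surjective ((I • ⊤ : Submodule A M).mkQ ∘ₗ f) := fun w ↦ by
    obtain ⟨c, hc⟩ := hv w
    obtain ⟨c, rfl⟩ := Ideal.Quotient.mk_surjective c
    exact ⟨c, hc⟩
  have hsurj := AdicCompletion.map_surjective_of_mkQ_comp_surjective (I := I) hf
  have hsurjn (n : ℕ) : Function.Surjective ((I ^ n • ⊤ : Submodule A M).mkQ ∘ₗ f) := fun w ↦ by
    obtain ⟨y, rfl⟩ := AdicCompletion.eval_surjective I M n w
    obtain ⟨z, rfl⟩ := hsurj y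
    obtain ⟨a, ha⟩ := Submodule.Quotient.mk_surjective _ (z.val n)
    refine ⟨a, ?_⟩
    rw [AdicCompletion.eval_apply, AdicCompletion.map_val_apply, ← ha]
    rfl
  have hinj : Function.Injective (AdicCompletion.map I f) := by
    rw [injective_iff_map_eq_zero]
    intro z hz
    ext n
    rcases eq_or_ne n 0 with rfl | hn
    · have : Subsingleton (A ⧸ (I ^ 0 • ⊤ : Submodule A A)) :=
        Submodule.Quotient.subsingleton_iff.2 (by simp)
      exact Subsingleton.elim _ _
    obtain ⟨a, ha⟩ := Submodule.Quotient.mk_surjective _ (z.val n)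
    have hzn : (AdicCompletion.map I f z).val n = 0 := by rw [hz]; rfl
    rw [AdicCompletion.map_val_apply, ← ha] at hzn
    have hax : a • x ∈ (I ^ n • ⊤ : Submodule A M) := (Submodule.Quotient.mk_eq_zero _).1 hzn
    rw [← ha, AdicCompletion.val_zero_apply, Submodule.Quotient.mk_eq_zero]
    have := mem_pow_of_smul_mem_pow_smul_top hπ hK hn (hsurjn n) (fun b hb ↦ ?_) hax
    · simpa using this
    · by_contra hbI
      obtain ⟨u, rfl⟩ := of_not_not hbI
      exact hx0 ((Submodule.smul_mem_iff_of_isUnit _ u.isUnit).1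
        (Submodule.smul_mono_left (Ideal.pow_le_self hn) hb))
  exact ⟨(AdicCompletion.ofLinearEquiv I M).trans
    ((LinearEquiv.ofBijective ((AdicCompletion.map I f).restrictScalars A) ⟨hinj, hsurj⟩).symm)⟩
end
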